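/- arXiv:2601.01951 — 2 statements merged into one kernel-verified Lean document; each statement's English description precedes it below -/
import Mathlib

section
/- Let X = (x, z, v) : [0, +∞) → ℝ³ be a global solution of the oscillator, and let M be one of the four half-planes M_x⁺ = {(x, z, v) : z = 0 and x ≥ 0}, M_x⁻ = {(x, z, v) : z = 0 and x ≤ 0}, M_z⁺ = {(x, z, v) : x = 0 and z ≥ 0}, M_z⁻ = {(x, z, v) : x = 0 and z ≤ 0}. If X is in M frequently (i.e., for every T > 0 there exists t > T with X(t) ∈ M), then X(t) → 0 as t → +∞. -/
open Filter Topology Set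

/-- **Barbalat's lemma** on a half-line. -/
theorem tendsto_deriv_zero_of_uniformContinuousOn {F φ : ℝ → ℝ} {l : ℝ}
    (hF : ∀ t ∈ Ici (0:ℝ), HasDerivWithinAt F (φ t) (Ici 0) t)
    (hφ : UniformContinuousOn φ (Ici 0)) (hl : Tendsto F atTop (𝓝 l)) :
    Tendsto φ atTop (𝓝 0) := by
  rw [Metric.tendsto_atTop]
  intro ε hε
  obtain ⟨δ, hδ, hφδ⟩ := Metric.uniformContinuousOn_iff.1 hφ (ε / 2) (by positivity)
  have hdiff : Tendsto (fun t => (F (t + δ / 2) - F t) / (δ / 2)) atTop (𝓝 0) := by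
    simpa using ((hl.comp (tendsto_atTop_add_const_right _ (δ / 2) tendsto_id)).sub hl).div_const
      (δ / 2)
  obtain ⟨N, hN⟩ := Metric.tendsto_atTop.1 hdiff (ε / 2) (by positivity)
  refine ⟨max N 0, fun t ht => ?_⟩
  have ht0 : 0 ≤ t := (le_max_right _ _).trans ht
  obtain ⟨s, ⟨hts, hst⟩, hs⟩ := exists_hasDerivAt_eq_slope F φ (show t < t + δ / 2 by linarith)
    (fun r hr => ((hF r (ht0.trans hr.1)).continuousWithinAt).mono
      fun q hq => ht0.trans hq.1)
    (fun r hr => (hF r (ht0.trans hr.1.le)).hasDerivAt (Ici_mem_nhds (ht0.trans_lt hr.1)))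
  have hslope := hN t ((le_max_left _ _).trans ht)
  have hclose := hφδ t ht0 s (ht0.trans hts.le) (by
    rw [Real.dist_eq, abs_lt]; constructor <;> linarith)
  rw [add_sub_cancel_left] at hs
  rw [← hs] at hslope
  calc dist (φ t) 0 ≤ dist (φ t) (φ s) + dist (φ s) 0 := dist_triangle _ _ _
    _ < ε := by linarith

theorem eq_of_mapClusterPt_of_tendsto {ι Y Z : Type*} [TopologicalSpace Y] [TopologicalSpace Z]
    [T2Space Z] {l : Filter ι} {X : ι → Y} {w : Y → Z} {p : Y} {b : Z} (hw : Continuous w)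
    (hp : MapClusterPt p l X) (hb : Tendsto (w ∘ X) l (𝓝 b)) : w p = b := by
  have h : ClusterPt (w p) (𝓝 b) := (hp.continuousAt_comp hw.continuousAt).clusterPt.mono hb
  exact @eq_of_nhds_neBot _ _ _ _ _ h

theorem tendsto_of_forall_mapClusterPt {ι Y Z : Type*} [TopologicalSpace Y] [TopologicalSpace Z]
    [T2Space Z] {l : Filter ι} {X : ι → Y} {w : Y → Z} {K : Set Y} {b : Z} (hK : IsCompact K)
    (hX : ∀ᶠ t in l, X t ∈ K) (hw : Continuous w) (h : ∀ p, MapClusterPt p l X → w p = b) :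
    Tendsto (w ∘ X) l (𝓝 b) := by
  refine tendsto_iff_ultrafilter _ _ _ |>.2 fun g hg => ?_
  obtain ⟨p, -, hp⟩ := hK.ultrafilter_le_nhds' (g.map X) (hX.filter_mono hg)
  have hp' : Tendsto X g (𝓝 p) := hp
  have := (hw.tendsto p).comp hp'
  rwa [h p (hp'.mapClusterPt.mono hg)] at this

section Autonomous

variable {E : Type*} [NormedAddCommGroup E] [NormedSpace ℝ E] {X : ℝ → E} {V : E → E} {K : Set E}

theorem tendsto_zero_of_hasDerivWithinAt_comp (hV : Continuous V)
    (hX : ∀ t ∈ Ici (0:ℝ), HasDerivWithinAt X (V (X t)) (Ici 0) t)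
    (hK : IsCompact K) (hXK : ∀ t ∈ Ici (0:ℝ), X t ∈ K) {F : ℝ → ℝ} {w : E → ℝ} {l : ℝ}
    (hw : Continuous w) (hF : ∀ t ∈ Ici (0:ℝ), HasDerivWithinAt F (w (X t)) (Ici 0) t)
    (hl : Tendsto F atTop (𝓝 l)) : Tendsto (w ∘ X) atTop (𝓝 0) := by
  obtain ⟨C, hC⟩ := hK.exists_bound_of_continuousOn hV.continuousOn
  have hC' : ∀ t ∈ Ici (0:ℝ), ‖V (X t)‖₊ ≤ C.toNNReal := fun t ht => by
    rw [← NNReal.coe_le_coe]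
    exact (hC _ (hXK t ht)).trans (Real.le_coe_toNNReal C)
  exact tendsto_deriv_zero_of_uniformContinuousOn hF
    ((hK.uniformContinuousOn_of_continuous hw.continuousOn).comp
      ((convex_Ici 0).lipschitzOnWith_of_nnnorm_hasDerivWithin_le hX hC').uniformContinuousOn
      hXK) hl

/-- If a continuous function `u` is constant on the limit set of a bounded trajectory, then its
derivative along the flow vanishes there. -/
theorem deriv_eq_zero_of_mapClusterPt (hV : Continuous V)
    (hX : ∀ t ∈ Ici (0:ℝ), HasDerivWithinAt X (V (X t)) (Ici 0) t)
    (hK : IsCompact K) (hXK : ∀ t ∈ Ici (0:ℝ), X t ∈ K) {u w : E → ℝ} {b : ℝ}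
    (hu : Continuous u) (hw : Continuous w)
    (huw : ∀ t ∈ Ici (0:ℝ), HasDerivWithinAt (u ∘ X) (w (X t)) (Ici 0) t)
    (hub : ∀ p, MapClusterPt p atTop X → u p = b) {p : E} (hp : MapClusterPt p atTop X) :
    w p = 0 :=
  eq_of_mapClusterPt_of_tendsto hw hp <| tendsto_zero_of_hasDerivWithinAt_comp hV hX hK hXK hw huw
    (tendsto_of_forall_mapClusterPt hK ((eventually_ge_atTop 0).mono hXK) hu hub)

end Autonomous

theorem exists_tendsto_of_hasDerivWithinAt_nonpos {F φ : ℝ → ℝ}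
    (hF : ∀ t ∈ Ici (0:ℝ), HasDerivWithinAt F (φ t) (Ici 0) t)
    (hφ : ∀ t ∈ Ici (0:ℝ), φ t ≤ 0) (hpos : ∀ t, 0 ≤ F t) :
    AntitoneOn F (Ici 0) ∧ ∃ l, Tendsto F atTop (𝓝 l) := by
  have hanti : AntitoneOn F (Ici 0) := antitoneOn_of_hasDerivWithinAt_nonpos (convex_Ici 0)
    (fun t ht => (hF t ht).continuousWithinAt)
    (fun t ht => (hF t (interior_subset ht)).mono interior_subset)
    (fun t ht => hφ t (interior_subset ht))
  refine ⟨hanti, _, (tendsto_atTop_ciInf (f := fun t => F (max t 0)) (fun a b hab => ?_)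
    ⟨0, ?_⟩).congr' ?_⟩
  · exact hanti (mem_Ici.2 (le_max_right a 0)) (mem_Ici.2 (le_max_right b 0)) (max_le_max_right 0 hab)
  · rintro _ ⟨t, rfl⟩
    exact hpos _
  · filter_upwards [eventually_ge_atTop 0] with t ht
    rw [max_eq_left ht]

section Potential

variable {h : ℝ → ℝ}

/-- The tangent-line inequality for the primitive of a monotone function. -/
theorem add_mul_sub_le_integral_of_monotone (hc : Continuous h) (hm : Monotone h) (a x : ℝ) :
    (∫ s in (0:ℝ)..a, h s) + h a * (x - a) ≤ ∫ s in (0:ℝ)..x, h s := by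
  have hi : ∀ p q, IntervalIntegrable h MeasureTheory.volume p q :=
    fun p q => hc.intervalIntegrable p q
  rw [← intervalIntegral.integral_add_adjacent_intervals (hi 0 a) (hi a x)]
  have hconst : ∫ _ in a..x, h a = h a * (x - a) := by simp [mul_comm]
  rw [← hconst]
  gcongr
  rcases le_total a x with hax | hxa
  · exact intervalIntegral.integral_mono_on hax (by simp) (hi _ _) fun s hs => hm hs.1
  · rw [intervalIntegral.integral_symm x a, intervalIntegral.integral_symm x a, neg_le_neg_iff]
    exact intervalIntegral.integral_mono_on hxa (hi _ _) (by simp) fun s hs => hm hs.2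

theorem integral_nonneg_of_monotone (hc : Continuous h) (hm : Monotone h) (h0 : h 0 = 0) (x : ℝ) :
    0 ≤ ∫ s in (0:ℝ)..x, h s := by
  simpa [h0] using add_mul_sub_le_integral_of_monotone hc hm 0 x

theorem eq_zero_of_integral_nonpos (hc : Continuous h) (hm : StrictMono h) (h0 : h 0 = 0) {x : ℝ}
    (hx : ∫ s in (0:ℝ)..x, h s ≤ 0) : x = 0 := by
  have h1 := add_mul_sub_le_integral_of_monotone hc hm.monotone (x / 2) x
  have h2 := integral_nonneg_of_monotone hc hm.monotone h0 (x / 2)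
  rcases lt_trichotomy x 0 with hneg | h | hpos
  · have := hm (show x / 2 < 0 by linarith)
    nlinarith
  · exact h
  · have := hm (show 0 < x / 2 by linarith)
    nlinarith

theorem exists_bound_of_integral_le (hc : Continuous h) (hm : StrictMono h) (h0 : h 0 = 0)
    (e : ℝ) : ∃ R, ∀ x, ∫ s in (0:ℝ)..x, h s ≤ e → x ∈ Icc (-R) R := by
  have hp : 0 < h 1 := h0 ▸ hm one_pos
  have hn : h (-1) < 0 := h0 ▸ hm neg_one_lt_zero
  refine ⟨max (1 + e / h 1) (1 + e / -h (-1)), fun x hx => ?_⟩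
  have hb : ∀ a, h a * (x - a) ≤ e := fun a => by
    have h1 := add_mul_sub_le_integral_of_monotone hc hm.monotone a x
    have h2 := integral_nonneg_of_monotone hc hm.monotone h0 a
    linarith
  constructor
  · have : -x - 1 ≤ e / -h (-1) := by
      rw [le_div_iff₀ (by linarith)]
      nlinarith [hb (-1)]
    linarith [le_max_right (1 + e / h 1) (1 + e / -h (-1))]
  · have : x - 1 ≤ e / h 1 := by
      rw [le_div_iff₀ hp]
      nlinarith [hb 1]
    linarith [le_max_left (1 + e / h 1) (1 + e / -h (-1))]

end Potential


/-- If a global solution of the oscillator visits one of the four half-planes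
`M_x⁺`, `M_x⁻`, `M_z⁺`, `M_z⁻` frequently, then it converges to the origin. -/
theorem frequently_in_halfplane_tendsto_zero
    (f₁ f₂ g₁ g₂ h₁ h₂ : ℝ → ℝ) (c : ℝ → ℝ → ℝ → ℝ)
    (hf₁lip : LocallyLipschitz f₁) (hf₂lip : LocallyLipschitz f₂)
    (hg₁lip : LocallyLipschitz g₁) (hg₂lip : LocallyLipschitz g₂)
    (hh₁lip : LocallyLipschitz h₁) (hh₂lip : LocallyLipschitz h₂)
    (hh₁mono : StrictMono h₁) (hh₂mono : StrictMono h₂)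
    (hf₁0 : f₁ 0 = 0) (hf₂0 : f₂ 0 = 0) (hg₁0 : g₁ 0 = 0) (hg₂0 : g₂ 0 = 0)
    (hh₁0 : h₁ 0 = 0) (hh₂0 : h₂ 0 = 0)
    (hfneg : ∀ z < (0:ℝ), 0 < f₁ z ∧ f₂ z < 0)
    (hfpos : ∀ z > (0:ℝ), f₁ z < 0 ∧ 0 < f₂ z)
    (hgpos : ∀ v > (0:ℝ), 0 < g₁ v ∧ g₂ v = 0)
    (hgneg : ∀ v < (0:ℝ), g₁ v = 0 ∧ g₂ v < 0)
    (hclip : LocallyLipschitz (fun p : ℝ × ℝ × ℝ => c p.1 p.2.1 p.2.2))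
    (hc0 : ∀ x z : ℝ, c x z 0 = 0)
    (hcv : ∀ x z v : ℝ, 0 ≤ v * c x z v)
    (x z v : ℝ → ℝ)
    (hx : ∀ t ∈ Set.Ici (0:ℝ), HasDerivWithinAt x (v t) (Set.Ici 0) t)
    (hz : ∀ t ∈ Set.Ici (0:ℝ), HasDerivWithinAt z
      (v t + f₁ (z t) * g₁ (v t) + f₂ (z t) * g₂ (v t)) (Set.Ici 0) t)
    (hv : ∀ t ∈ Set.Ici (0:ℝ), HasDerivWithinAt v
      (-h₁ (x t) - h₂ (z t) - c (x t) (z t) (v t)) (Set.Ici 0) t)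
    (hfreq :
      (∀ T > (0:ℝ), ∃ t > T, z t = 0 ∧ 0 ≤ x t) ∨
      (∀ T > (0:ℝ), ∃ t > T, z t = 0 ∧ x t ≤ 0) ∨
      (∀ T > (0:ℝ), ∃ t > T, x t = 0 ∧ 0 ≤ z t) ∨
      (∀ T > (0:ℝ), ∃ t > T, x t = 0 ∧ z t ≤ 0)) :
    Filter.Tendsto x Filter.atTop (nhds 0) ∧
    Filter.Tendsto z Filter.atTop (nhds 0) ∧
    Filter.Tendsto v Filter.atTop (nhds 0) := by
  have hch₁ := hh₁lip.continuous
  have hch₂ := hh₂lip.continuous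
  have hcc := hclip.continuous
  have hcf₁ := hf₁lip.continuous
  have hcf₂ := hf₂lip.continuous
  have hcg₁ := hg₁lip.continuous
  have hcg₂ := hg₂lip.continuous
  have hsign : ∀ {h : ℝ → ℝ}, StrictMono h → h 0 = 0 → ∀ y, (y < 0 → h y < 0) ∧ (0 < y → 0 < h y) :=
    fun hm h0 y => ⟨fun hy => h0 ▸ hm hy, fun hy => h0 ▸ hm hy⟩
  have hdH : ∀ {h : ℝ → ℝ}, Continuous h → ∀ y, HasDerivAt (fun u => ∫ s in (0:ℝ)..u, h s) (h y) y :=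
    fun hc y => (hc.integral_hasStrictDerivAt 0 y).hasDerivAt
  let X : ℝ → ℝ × ℝ × ℝ := fun t => (x t, z t, v t)
  let V : ℝ × ℝ × ℝ → ℝ × ℝ × ℝ := fun p =>
    (p.2.2, p.2.2 + f₁ p.2.1 * g₁ p.2.2 + f₂ p.2.1 * g₂ p.2.2,
      -h₁ p.1 - h₂ p.2.1 - c p.1 p.2.1 p.2.2)
  let En : ℝ × ℝ × ℝ → ℝ := fun p =>
    (∫ s in (0:ℝ)..p.1, h₁ s) + (∫ s in (0:ℝ)..p.2.1, h₂ s) + p.2.2 ^ 2 / 2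
  let W : ℝ × ℝ × ℝ → ℝ := fun p =>
    h₂ p.2.1 * (f₁ p.2.1 * g₁ p.2.2 + f₂ p.2.1 * g₂ p.2.2) - p.2.2 * c p.1 p.2.1 p.2.2
  have hV : Continuous V := by fun_prop
  have hW : Continuous W := by fun_prop
  have hEn : Continuous En := by
    have hH₁ := continuous_iff_continuousAt.2 fun y => (hdH hch₁ y).continuousAt
    have hH₂ := continuous_iff_continuousAt.2 fun y => (hdH hch₂ y).continuousAt
    exact ((hH₁.comp continuous_fst).add (hH₂.comp (by fun_prop))).add (by fun_prop)
  have hX : ∀ t ∈ Ici (0:ℝ), HasDerivWithinAt X (V (X t)) (Ici 0) t := fun t ht =>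
    (hx t ht).prodMk ((hz t ht).prodMk (hv t ht))
  have hEnX : ∀ t ∈ Ici (0:ℝ), HasDerivWithinAt (En ∘ X) (W (X t)) (Ici 0) t := fun t ht => by
    have h1 := (hdH hch₁ (x t)).comp_hasDerivWithinAt t (hx t ht)
    have h2 := (hdH hch₂ (z t)).comp_hasDerivWithinAt t (hz t ht)
    have h3 := ((hv t ht).pow 2).div_const 2
    refine ((h1.add h2).add h3).congr_deriv ?_
    simp only [W, X]
    push_cast
    ring
  -- The energy dissipated by the hysteretic term.
  have hdiss : ∀ ζ ν : ℝ, h₂ ζ * (f₁ ζ * g₁ ν + f₂ ζ * g₂ ν) ≤ 0 ∧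
      (h₂ ζ * (f₁ ζ * g₁ ν + f₂ ζ * g₂ ν) = 0 → ν * ζ = 0) := by
    intro ζ ν
    have key : ζ ≠ 0 → ν ≠ 0 → h₂ ζ * (f₁ ζ * g₁ ν + f₂ ζ * g₂ ν) < 0 := by
      intro hζ hν
      rcases lt_or_gt_of_ne hζ with hζ | hζ <;> rcases lt_or_gt_of_ne hν with hν | hν
      · rw [(hgneg ν hν).1, mul_zero, zero_add]
        exact mul_neg_of_neg_of_pos ((hsign hh₂mono hh₂0 ζ).1 hζ)
          (mul_pos_of_neg_of_neg (hfneg ζ hζ).2 (hgneg ν hν).2)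
      · rw [(hgpos ν hν).2, mul_zero, add_zero]
        exact mul_neg_of_neg_of_pos ((hsign hh₂mono hh₂0 ζ).1 hζ)
          (mul_pos (hfneg ζ hζ).1 (hgpos ν hν).1)
      · rw [(hgneg ν hν).1, mul_zero, zero_add]
        exact mul_neg_of_pos_of_neg ((hsign hh₂mono hh₂0 ζ).2 hζ)
          (mul_neg_of_pos_of_neg (hfpos ζ hζ).2 (hgneg ν hν).2)
      · rw [(hgpos ν hν).2, mul_zero, add_zero]
        exact mul_neg_of_pos_of_neg ((hsign hh₂mono hh₂0 ζ).2 hζ)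
          (mul_neg_of_neg_of_pos (hfpos ζ hζ).1 (hgpos ν hν).1)
    by_cases hζ : ζ = 0
    · simp [hζ, hh₂0]
    by_cases hν : ν = 0
    · simp [hν, hg₁0, hg₂0]
    exact ⟨(key hζ hν).le, fun h => absurd h (key hζ hν).ne⟩
  have hWle : ∀ p, W p ≤ 0 := fun p =>
    sub_nonpos_of_le ((hdiss p.2.1 p.2.2).1.trans (hcv _ _ _))
  have hH₁pos := integral_nonneg_of_monotone hch₁ hh₁mono.monotone hh₁0
  have hH₂pos := integral_nonneg_of_monotone hch₂ hh₂mono.monotone hh₂0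
  have hEnpos : ∀ p, 0 ≤ En p := fun p =>
    add_nonneg (add_nonneg (hH₁pos p.1) (hH₂pos p.2.1)) (by positivity)
  obtain ⟨hanti, e, he⟩ := exists_tendsto_of_hasDerivWithinAt_nonpos hEnX
    (fun t _ => hWle (X t)) (fun t => hEnpos (X t))
  obtain ⟨K, hK, hXK⟩ : ∃ K, IsCompact K ∧ ∀ t ∈ Ici (0:ℝ), X t ∈ K := by
    obtain ⟨R₁, hR₁⟩ := exists_bound_of_integral_le hch₁ hh₁mono hh₁0 (En (X 0))
    obtain ⟨R₂, hR₂⟩ := exists_bound_of_integral_le hch₂ hh₂mono hh₂0 (En (X 0))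
    refine ⟨Icc (-R₁) R₁ ×ˢ Icc (-R₂) R₂ ×ˢ Icc (-(1 + 2 * En (X 0))) (1 + 2 * En (X 0)),
      isCompact_Icc.prod (isCompact_Icc.prod isCompact_Icc), fun t ht => ?_⟩
    have hle : (∫ s in (0:ℝ)..x t, h₁ s) + (∫ s in (0:ℝ)..z t, h₂ s) + v t ^ 2 / 2 ≤ En (X 0) :=
      hanti self_mem_Ici ht ht
    have h1 := hH₁pos (x t)
    have h2 := hH₂pos (z t)
    have h3 := sq_nonneg (v t)
    refine ⟨hR₁ _ (by linarith), hR₂ _ (by linarith), ?_, ?_⟩ <;>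
      nlinarith [sq_nonneg (v t - 1), sq_nonneg (v t + 1)]
  have hXev : ∀ᶠ t in atTop, X t ∈ K := (eventually_ge_atTop 0).mono hXK
  have hlim_En : ∀ p, MapClusterPt p atTop X → En p = e := fun p hp =>
    eq_of_mapClusterPt_of_tendsto hEn hp he
  have hlim_vz : ∀ p, MapClusterPt p atTop X → p.2.2 * p.2.1 = 0 := fun p hp => by
    have hWp : W p = 0 := deriv_eq_zero_of_mapClusterPt hV hX hK hXK hEn hW hEnX hlim_En hp
    have h1 := hdiss p.2.1 p.2.2
    have h2 := hcv p.1 p.2.1 p.2.2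
    refine h1.2 (le_antisymm h1.1 ?_)
    simp only [W] at hWp
    linarith
  have hlim_v : ∀ p, MapClusterPt p atTop X → p.2.2 = 0 := fun p hp => by
    have hd : (V p).2.2 * p.2.1 + p.2.2 * (V p).2.1 = 0 :=
      deriv_eq_zero_of_mapClusterPt (u := fun p => p.2.2 * p.2.1)
        (w := fun p => (V p).2.2 * p.2.1 + p.2.2 * (V p).2.1) hV hX hK hXK (by fun_prop)
        (by fun_prop) (fun t ht => (hv t ht).mul (hz t ht)) hlim_vz hp
    rcases mul_eq_zero.1 (hlim_vz p hp) with h | h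
    · exact h
    · simpa [V, h, hf₁0, hf₂0] using hd
  have hlim_h : ∀ p, MapClusterPt p atTop X → h₁ p.1 + h₂ p.2.1 = 0 := fun p hp => by
    have hd : (V p).2.2 = 0 :=
      deriv_eq_zero_of_mapClusterPt (u := fun p => p.2.2) (w := fun p => (V p).2.2)
        hV hX hK hXK (by fun_prop) (by fun_prop) hv hlim_v hp
    simp only [V, hlim_v p hp, hc0] at hd
    linarith
  have hfreq' : ∃ᶠ t in atTop, X t ∈ K ∩ {p | p.1 * p.2.1 = 0} := by
    refine Frequently.and_eventually ?_ hXev |>.mono fun t ht => ⟨ht.2, ht.1⟩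
    refine frequently_atTop.2 fun T => ?_
    have hpos : 0 < max T 1 := lt_max_of_lt_right one_pos
    rcases hfreq with h | h | h | h <;> obtain ⟨t, ht, h0, -⟩ := h _ hpos <;>
      exact ⟨t, (le_max_left _ _).trans ht.le, by simp [X, h0]⟩
  obtain ⟨p, hpM, hp⟩ := (hK.inter_right (isClosed_eq (by fun_prop)
    continuous_const)).exists_mapClusterPt_of_frequently hfreq'
  have hp0 : p = 0 := by
    have hv0 := hlim_v p hp
    have hh := hlim_h p hp
    rcases mul_eq_zero.1 hpM.2 with h | h
    · rw [h, hh₁0, zero_add, ← hh₂0] at hh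
      exact Prod.ext h (Prod.ext (hh₂mono.injective hh) hv0)
    · rw [h, hh₂0, add_zero, ← hh₁0] at hh
      exact Prod.ext (hh₁mono.injective hh) (Prod.ext h hv0)
  have he0 : e = 0 := by
    rw [← hlim_En p hp, hp0]
    simp [En]
  have hlim : Tendsto X atTop (𝓝 0) := by
    refine hK.tendsto_nhds_of_unique_mapClusterPt hXev fun q _ hq => ?_
    have hEq : (∫ s in (0:ℝ)..q.1, h₁ s) + (∫ s in (0:ℝ)..q.2.1, h₂ s) + q.2.2 ^ 2 / 2 = 0 :=
      (hlim_En q hq).trans he0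
    have h1 := hH₁pos q.1
    have h2 := hH₂pos q.2.1
    have h3 := sq_nonneg q.2.2
    exact Prod.ext (eq_zero_of_integral_nonpos hch₁ hh₁mono hh₁0 (by linarith))
      (Prod.ext (eq_zero_of_integral_nonpos hch₂ hh₂mono hh₂0 (by linarith)) (hlim_v q hq))
  exact ⟨hlim.fst_nhds, hlim.snd_nhds.fst_nhds, hlim.snd_nhds.snd_nhds⟩
end

section
/- Let X : [0, +∞) → ℝ³ be a global solution of the oscillator with X₀ = X(0). If X is eventually in N_nw or eventually in N_se, then there exists X* ∈ E with V(X*) ≤ V(X₀) such that X(t) → X* as t → +∞, where E = {(x, z, v) ∈ ℝ³ : h₁(x) = −h₂(z) and v = 0} and V(x, z, v) = ∫₀ˣ h₁(s) ds + ∫₀ᶻ h₂(s) ds + v²/2. -/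
open Filter Set Topology

/-- A version of Barbalat's lemma: if `F` converges at infinity and its derivative is the sum of a
uniformly continuous function `g` and a function tending to `0`, then `g` tends to `0`. -/
theorem tendsto_zero_of_tendsto_of_hasDerivAt_add {F g e : ℝ → ℝ} {l : ℝ}
    (hF : Tendsto F atTop (𝓝 l)) (he : Tendsto e atTop (𝓝 0))
    (hg : UniformContinuousOn g (Ici 0))
    (hd : ∀ t > 0, HasDerivAt F (g t + e t) t) : Tendsto g atTop (𝓝 0) := by
  rw [Metric.tendsto_atTop]
  intro ε hε
  obtain ⟨δ, hδ, hδg⟩ := Metric.uniformContinuousOn_iff.1 hg (ε / 4) (by linarith)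
  obtain ⟨A, hA⟩ := Metric.tendsto_atTop.1 hF (ε * δ / 16) (by positivity)
  obtain ⟨B, hB⟩ := Metric.tendsto_atTop.1 he (ε / 4) (by linarith)
  refine ⟨max (max A B) 1, fun t ht => ?_⟩
  have htA : A ≤ t := le_trans (le_trans (le_max_left _ _) (le_max_left _ _)) ht
  have htB : B ≤ t := le_trans (le_trans (le_max_right _ _) (le_max_left _ _)) ht
  have ht1 : 1 ≤ t := le_trans (le_max_right _ _) ht
  obtain ⟨s, ⟨hs1, hs2⟩, hs⟩ := exists_hasDerivAt_eq_slope F (fun s => g s + e s)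
    (show t < t + δ / 2 by linarith)
    (fun s hs => (hd s (by linarith [hs.1])).continuousAt.continuousWithinAt)
    (fun s hs => hd s (by linarith [hs.1]))
  have h1 := hA t htA
  have h2 := hA (t + δ / 2) (by linarith)
  have h3 := hB s (by linarith)
  have h4 := hδg s (show (0 : ℝ) ≤ s by linarith) t (show (0 : ℝ) ≤ t by linarith)
    (by rw [Real.dist_eq, abs_lt]; constructor <;> linarith)
  rw [eq_div_iff (by linarith)] at hs
  rw [Real.dist_eq, abs_lt] at h1 h2 h3 h4 ⊢
  have h5 : g s + e s < ε / 4 := by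
    by_contra! h
    nlinarith
  have h6 : -(ε / 4) < g s + e s := by
    by_contra! h
    nlinarith
  constructor <;> linarith

theorem MapClusterPt.eq_of_tendsto_comp {ι α β : Type*} [TopologicalSpace α] [TopologicalSpace β]
    [T2Space β] {F : Filter ι} {X : ι → α} {p : α} {f : α → β} {l : β}
    (hp : MapClusterPt p F X) (hf : ContinuousAt f p) (hl : Tendsto (fun t => f (X t)) F (𝓝 l)) :
    f p = l := by
  have h : ClusterPt (f p) (𝓝 l) := (hp.continuousAt_comp hf).clusterPt.mono hl
  have : NeBot (𝓝 (f p) ⊓ 𝓝 l) := h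
  exact eq_of_nhds_neBot this

/-- If a curve stays in a compact set on which `f` vanishes only where `g` does, and `f` tends to
`0` along the curve, then so does `g`. -/
theorem IsCompact.tendsto_zero_of_tendsto_zero {ι α : Type*} [TopologicalSpace α] {F : Filter ι}
    {X : ι → α} {K : Set α} (hK : IsCompact K) (hX : ∀ᶠ t in F, X t ∈ K) {f g : α → ℝ}
    (hf : Continuous f) (hg : Continuous g) (hfg : ∀ p ∈ K, f p = 0 → g p = 0)
    (h : Tendsto (fun t => f (X t)) F (𝓝 0)) : Tendsto (fun t => g (X t)) F (𝓝 0) := by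
  rw [tendsto_iff_ultrafilter]
  intro U hU
  obtain ⟨p, hpK, hp⟩ := hK.ultrafilter_le_nhds (U.map X) (le_principal_iff.2 (hU hX))
  have hXp : Tendsto X U (𝓝 p) := hp
  have h0 : f p = 0 := tendsto_nhds_unique (hf.continuousAt.tendsto.comp hXp) (h.mono_left hU)
  have := hg.continuousAt.tendsto.comp hXp
  rwa [hfg p hpK h0] at this

/-- The primitive of a monotone function lies above its tangent lines. -/
theorem Monotone.mul_sub_le_integral {h : ℝ → ℝ} (hm : Monotone h) (a b : ℝ) :
    h a * (b - a) ≤ ∫ s in a..b, h s := by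
  rcases le_total a b with hab | hab
  · have := intervalIntegral.integral_mono_on (μ := MeasureTheory.volume) hab
      (intervalIntegrable_const (c := h a))
      (hm.intervalIntegrable) (fun s hs => hm hs.1)
    simp only [intervalIntegral.integral_const, smul_eq_mul] at this
    linarith
  · have := intervalIntegral.integral_mono_on (μ := MeasureTheory.volume) hab
      hm.intervalIntegrable (intervalIntegrable_const (c := h a)) (fun s hs => hm hs.2)
    simp only [intervalIntegral.integral_const, smul_eq_mul] at this
    rw [intervalIntegral.integral_symm]
    linarith

theorem Monotone.integral_zero_nonneg {h : ℝ → ℝ} (hm : Monotone h) (h0 : h 0 = 0) (b : ℝ) :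
    0 ≤ ∫ s in (0 : ℝ)..b, h s := by
  simpa [h0] using hm.mul_sub_le_integral 0 b

/-- The primitive of a strictly increasing function vanishing at `0` is coercive. -/
theorem StrictMono.exists_abs_le_of_integral_le {h : ℝ → ℝ} (hm : StrictMono h) (h0 : h 0 = 0)
    (C : ℝ) : ∃ R, ∀ b, (∫ s in (0 : ℝ)..b, h s) ≤ C → |b| ≤ R := by
  have h1 : 0 < h 1 := h0 ▸ hm one_pos
  have h2 : h (-1) < 0 := h0 ▸ hm (by norm_num)
  have key : ∀ a b, h a * (b - a) ≤ ∫ s in (0 : ℝ)..b, h s := fun a b => by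
    have := hm.monotone.mul_sub_le_integral a b
    have h3 := hm.monotone.integral_zero_nonneg h0 a
    have := intervalIntegral.integral_add_adjacent_intervals (μ := MeasureTheory.volume)
      (hm.monotone.intervalIntegrable (a := 0) (b := a))
      (hm.monotone.intervalIntegrable (a := a) (b := b))
    linarith
  refine ⟨max (C / h 1 + 1) (C / (-h (-1)) + 1), fun b hb => abs_le.2 ⟨?_, ?_⟩⟩
  · have : -b - 1 ≤ C / (-h (-1)) := by
      rw [le_div_iff₀ (by linarith)]
      nlinarith [key (-1) b]
    linarith [le_max_right (C / h 1 + 1) (C / (-h (-1)) + 1)]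
  · have : b - 1 ≤ C / h 1 := by
      rw [le_div_iff₀ h1]
      nlinarith [key 1 b]
    linarith [le_max_left (C / h 1 + 1) (C / (-h (-1)) + 1)]

/-- A function whose derivative is nonpositive beyond some time and which is bounded below
converges. -/
theorem exists_tendsto_atTop_of_hasDerivAt_nonpos {w w' : ℝ → ℝ} {T m : ℝ}
    (hd : ∀ t > T, HasDerivAt w (w' t) t) (hw : ∀ t > T, w' t ≤ 0) (hm : ∀ t > T, m ≤ w t) :
    ∃ l, Tendsto w atTop (𝓝 l) := by
  have anti : AntitoneOn w (Ioi T) := by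
    refine antitoneOn_of_deriv_nonpos (convex_Ioi T)
      (fun t ht => (hd t ht).continuousAt.continuousWithinAt) ?_ ?_
    · rw [interior_Ioi]
      exact fun t ht => (hd t ht).differentiableAt.differentiableWithinAt
    · rw [interior_Ioi]
      exact fun t ht => (hd t ht).deriv ▸ hw t ht
  have anti' : Antitone fun t => w (max t (T + 1)) := fun s t hst =>
    anti (lt_of_lt_of_le (lt_add_one T) (le_max_right _ _))
      (lt_of_lt_of_le (lt_add_one T) (le_max_right _ _)) (max_le_max_right _ hst)
  have bdd : BddBelow (range fun t => w (max t (T + 1))) :=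
    ⟨m, by rintro _ ⟨t, rfl⟩; exact hm _ (lt_of_lt_of_le (lt_add_one T) (le_max_right _ _))⟩
  refine ⟨_, (tendsto_atTop_ciInf anti' bdd).congr' ?_⟩
  filter_upwards [eventually_ge_atTop (T + 1)] with t ht
  rw [max_eq_left ht]


/-- If a global solution of the oscillator is eventually in `N_nw` or
eventually in `N_se`, then it converges to an equilibrium point `X* ∈ E` with
`V(X*) ≤ V(X₀)`. -/
theorem eventually_Nnw_or_Nse_tendsto_equilibrium
    (f₁ f₂ g₁ g₂ h₁ h₂ : ℝ → ℝ) (c : ℝ → ℝ → ℝ → ℝ)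
    (hf₁lip : LocallyLipschitz f₁) (hf₂lip : LocallyLipschitz f₂)
    (hg₁lip : LocallyLipschitz g₁) (hg₂lip : LocallyLipschitz g₂)
    (hh₁lip : LocallyLipschitz h₁) (hh₂lip : LocallyLipschitz h₂)
    (hh₁mono : StrictMono h₁) (hh₂mono : StrictMono h₂)
    (hf₁0 : f₁ 0 = 0) (hf₂0 : f₂ 0 = 0) (hg₁0 : g₁ 0 = 0) (hg₂0 : g₂ 0 = 0)
    (hh₁0 : h₁ 0 = 0) (hh₂0 : h₂ 0 = 0)
    (hfneg : ∀ z < (0:ℝ), 0 < f₁ z ∧ f₂ z < 0)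
    (hfpos : ∀ z > (0:ℝ), f₁ z < 0 ∧ 0 < f₂ z)
    (hgpos : ∀ v > (0:ℝ), 0 < g₁ v ∧ g₂ v = 0)
    (hgneg : ∀ v < (0:ℝ), g₁ v = 0 ∧ g₂ v < 0)
    (hclip : LocallyLipschitz (fun p : ℝ × ℝ × ℝ => c p.1 p.2.1 p.2.2))
    (hc0 : ∀ x z : ℝ, c x z 0 = 0)
    (hcv : ∀ x z v : ℝ, 0 ≤ v * c x z v)
    (x z v : ℝ → ℝ)
    (hx : ∀ t ∈ Set.Ici (0:ℝ), HasDerivWithinAt x (v t) (Set.Ici 0) t)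
    (hz : ∀ t ∈ Set.Ici (0:ℝ), HasDerivWithinAt z
      (v t + f₁ (z t) * g₁ (v t) + f₂ (z t) * g₂ (v t)) (Set.Ici 0) t)
    (hv : ∀ t ∈ Set.Ici (0:ℝ), HasDerivWithinAt v
      (-h₁ (x t) - h₂ (z t) - c (x t) (z t) (v t)) (Set.Ici 0) t)
    (hN : (∃ T ≥ (0:ℝ), ∀ t > T, x t < 0 ∧ 0 < z t) ∨
          (∃ T ≥ (0:ℝ), ∀ t > T, 0 < x t ∧ z t < 0)) :
    ∃ xs zs : ℝ,
      h₁ xs = -h₂ zs ∧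
      (∫ s in (0:ℝ)..xs, h₁ s) + (∫ s in (0:ℝ)..zs, h₂ s) + (0:ℝ) ^ 2 / 2 ≤
        (∫ s in (0:ℝ)..(x 0), h₁ s) + (∫ s in (0:ℝ)..(z 0), h₂ s) +
          (v 0) ^ 2 / 2 ∧
      Filter.Tendsto x Filter.atTop (nhds xs) ∧
      Filter.Tendsto z Filter.atTop (nhds zs) ∧
      Filter.Tendsto v Filter.atTop (nhds 0) := by
  have ch₁ := hh₁lip.continuous
  have ch₂ := hh₂lip.continuous
  set φ : ℝ × ℝ × ℝ → ℝ := fun p => f₁ p.2.1 * g₁ p.2.2 + f₂ p.2.1 * g₂ p.2.2 with hφ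
  set ψ : ℝ × ℝ × ℝ → ℝ := fun p => c p.1 p.2.1 p.2.2 with hψ
  have cφ : Continuous φ := by
    have := hf₁lip.continuous
    have := hf₂lip.continuous
    have := hg₁lip.continuous
    have := hg₂lip.continuous
    fun_prop
  have cψ : Continuous ψ := hclip.continuous
  have φ_nonpos : ∀ p : ℝ × ℝ × ℝ, 0 < p.2.1 → φ p ≤ 0 := by
    rintro ⟨a, b, d⟩ hb
    obtain ⟨h1, h2⟩ := hfpos b hb
    rcases lt_trichotomy d 0 with hd | rfl | hd
    · obtain ⟨h3, h4⟩ := hgneg d hd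
      simp only [hφ, h3]; nlinarith
    · simp [hφ, hg₁0, hg₂0]
    · obtain ⟨h3, h4⟩ := hgpos d hd
      simp only [hφ, h4]; nlinarith
  have φ_nonneg : ∀ p : ℝ × ℝ × ℝ, p.2.1 < 0 → 0 ≤ φ p := by
    rintro ⟨a, b, d⟩ hb
    obtain ⟨h1, h2⟩ := hfneg b hb
    rcases lt_trichotomy d 0 with hd | rfl | hd
    · obtain ⟨h3, h4⟩ := hgneg d hd
      simp only [hφ, h3]; nlinarith
    · simp [hφ, hg₁0, hg₂0]
    · obtain ⟨h3, h4⟩ := hgpos d hd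
      simp only [hφ, h4]; nlinarith
  have φ_zero : ∀ p : ℝ × ℝ × ℝ, φ p = 0 → p.2.1 * p.2.2 = 0 := by
    rintro ⟨a, b, d⟩ h
    by_contra hne
    obtain ⟨hb, hd⟩ := mul_ne_zero_iff.1 hne
    have hf : f₁ b ≠ 0 ∧ f₂ b ≠ 0 := by
      rcases lt_or_gt_of_ne hb with hb | hb
      · exact ⟨(hfneg b hb).1.ne', (hfneg b hb).2.ne⟩
      · exact ⟨(hfpos b hb).1.ne, (hfpos b hb).2.ne'⟩
    rcases lt_or_gt_of_ne hd with hd | hd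
    · obtain ⟨h3, h4⟩ := hgneg d hd
      simp only [hφ, h3, mul_zero, zero_add] at h
      exact mul_ne_zero hf.2 h4.ne h
    · obtain ⟨h3, h4⟩ := hgpos d hd
      simp only [hφ, h4, mul_zero, add_zero] at h
      exact mul_ne_zero hf.1 h3.ne' h
  set X : ℝ → ℝ × ℝ × ℝ := fun t => (x t, z t, v t) with hX
  set G : ℝ × ℝ × ℝ → ℝ × ℝ × ℝ :=
    fun p => (p.2.2, p.2.2 + φ p, -h₁ p.1 - h₂ p.2.1 - ψ p) with hG
  have cG : Continuous G := by fun_prop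
  have hXd : ∀ t ∈ Ici (0 : ℝ), HasDerivWithinAt X (G (X t)) (Ici 0) t := fun t ht => by
    refine (hx t ht).prodMk (HasDerivWithinAt.prodMk ?_ (hv t ht))
    exact (hz t ht).congr_deriv (add_assoc _ _ _)
  have cX : ContinuousOn X (Ici 0) := fun t ht => (hXd t ht).continuousWithinAt
  have hx' : ∀ t > 0, HasDerivAt x (v t) t := fun t ht =>
    (hx t ht.le).hasDerivAt (Ici_mem_nhds ht)
  have hz' : ∀ t > 0, HasDerivAt z (v t + φ (X t)) t := fun t ht =>
    ((hz t ht.le).hasDerivAt (Ici_mem_nhds ht)).congr_deriv (add_assoc _ _ _)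
  have hv' : ∀ t > 0, HasDerivAt v (-h₁ (x t) - h₂ (z t) - ψ (X t)) t := fun t ht =>
    (hv t ht.le).hasDerivAt (Ici_mem_nhds ht)
  -- The energy is nonincreasing.
  set H₁ : ℝ → ℝ := fun a => ∫ s in (0 : ℝ)..a, h₁ s with hH₁
  set H₂ : ℝ → ℝ := fun a => ∫ s in (0 : ℝ)..a, h₂ s with hH₂
  have dH₁ : ∀ a, HasDerivAt H₁ (h₁ a) a := fun a => (ch₁.integral_hasStrictDerivAt 0 a).hasDerivAt
  have dH₂ : ∀ a, HasDerivAt H₂ (h₂ a) a := fun a => (ch₂.integral_hasStrictDerivAt 0 a).hasDerivAt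
  have cH₁ : Continuous H₁ := continuous_iff_continuousAt.2 fun a => (dH₁ a).continuousAt
  have cH₂ : Continuous H₂ := continuous_iff_continuousAt.2 fun a => (dH₂ a).continuousAt
  set V : ℝ × ℝ × ℝ → ℝ := fun p => H₁ p.1 + H₂ p.2.1 + p.2.2 ^ 2 / 2 with hV
  have cV : Continuous V := by fun_prop
  have V_anti : AntitoneOn (fun t => V (X t)) (Ici 0) := by
    have hd : ∀ t > 0, HasDerivAt (fun t => V (X t)) (h₂ (z t) * φ (X t) - v t * ψ (X t)) t :=
      fun t ht => by
        refine ((((dH₁ (x t)).comp t (hx' t ht)).add ((dH₂ (z t)).comp t (hz' t ht))).add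
          (((hv' t ht).pow 2).div_const 2)).congr_deriv ?_
        ring
    refine antitoneOn_of_deriv_nonpos (convex_Ici 0) (cV.comp_continuousOn cX) ?_ ?_
    · rw [interior_Ici]
      exact fun t ht => (hd t ht).differentiableAt.differentiableWithinAt
    · rw [interior_Ici]
      intro t ht
      rw [(hd t ht).deriv]
      have h1 : 0 ≤ v t * ψ (X t) := hcv _ _ _
      rcases lt_trichotomy (z t) 0 with h | h | h
      · have h2 := φ_nonneg (X t) h
        have h3 : h₂ (z t) < 0 := hh₂0 ▸ hh₂mono h
        nlinarith
      · rw [h, hh₂0]; linarith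
      · have h2 := φ_nonpos (X t) h
        have h3 : 0 < h₂ (z t) := hh₂0 ▸ hh₂mono h
        nlinarith
  have V_le : ∀ t ≥ 0, V (X t) ≤ V (X 0) := fun t ht => V_anti self_mem_Ici ht ht
  -- Trajectories are bounded.
  obtain ⟨R₁, hR₁⟩ := hh₁mono.exists_abs_le_of_integral_le hh₁0 (V (X 0))
  obtain ⟨R₂, hR₂⟩ := hh₂mono.exists_abs_le_of_integral_le hh₂0 (V (X 0))
  set K : Set (ℝ × ℝ × ℝ) := Icc (-R₁) R₁ ×ˢ Icc (-R₂) R₂ ×ˢ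
    Icc (-√(2 * V (X 0))) (√(2 * V (X 0))) with hK
  have K_compact : IsCompact K := isCompact_Icc.prod (isCompact_Icc.prod isCompact_Icc)
  have hXK : ∀ t ≥ 0, X t ∈ K := fun t ht => by
    have h1 : H₁ (x t) + H₂ (z t) + v t ^ 2 / 2 ≤ V (X 0) := V_le t ht
    have h2 : 0 ≤ H₁ (x t) := hh₁mono.monotone.integral_zero_nonneg hh₁0 _
    have h3 : 0 ≤ H₂ (z t) := hh₂mono.monotone.integral_zero_nonneg hh₂0 _
    have h4 := sq_nonneg (v t)
    exact ⟨abs_le.1 (hR₁ _ (by linarith)), abs_le.1 (hR₂ _ (by linarith)),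
      abs_le.1 (Real.abs_le_sqrt (by linarith))⟩
  have hXK' : ∀ᶠ t in atTop, X t ∈ K := (eventually_ge_atTop 0).mono hXK
  -- Continuous observables are uniformly continuous along the trajectory.
  have ucX : UniformContinuousOn X (Ici 0) := by
    obtain ⟨C, hC⟩ := K_compact.exists_bound_of_continuousOn cG.continuousOn
    refine ((convex_Ici (0 : ℝ)).lipschitzOnWith_of_nnnorm_hasDerivWithin_le (C := C.toNNReal)
      hXd fun t ht => ?_).uniformContinuousOn
    rw [← NNReal.coe_le_coe, coe_nnnorm]
    exact (hC _ (hXK t ht)).trans (Real.le_coe_toNNReal C)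
  have uc : ∀ f : ℝ × ℝ × ℝ → ℝ, Continuous f → UniformContinuousOn (fun t => f (X t)) (Ici 0) :=
    fun f hf => (K_compact.uniformContinuousOn_of_continuous hf.continuousOn).comp ucX
      fun t ht => hXK t ht
  -- `z - x` converges.
  have hw : ∀ t > 0, HasDerivAt (fun t => z t - x t) (φ (X t)) t := fun t ht =>
    ((hz' t ht).sub (hx' t ht)).congr_deriv (by ring)
  obtain ⟨L, hL⟩ : ∃ L, Tendsto (fun t => z t - x t) atTop (𝓝 L) := by
    rcases hN with ⟨T, hT, h⟩ | ⟨T, hT, h⟩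
    · exact exists_tendsto_atTop_of_hasDerivAt_nonpos (m := 0)
        (fun t ht => hw t (by linarith)) (fun t ht => φ_nonpos _ (h t ht).2)
        (fun t ht => by linarith [(h t ht).1, (h t ht).2])
    · obtain ⟨L, hL⟩ := exists_tendsto_atTop_of_hasDerivAt_nonpos (m := 0) (T := T)
        (fun t ht => (hw t (by linarith)).neg)
        (fun t ht => neg_nonpos.2 (φ_nonneg _ (h t ht).2))
        (fun t ht => by simp only [Pi.neg_apply]; linarith [(h t ht).1, (h t ht).2])
      exact ⟨-L, by simpa using hL.neg⟩
  have φ_lim : Tendsto (fun t => φ (X t)) atTop (𝓝 0) :=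
    tendsto_zero_of_tendsto_of_hasDerivAt_add hL (e := fun _ => 0) tendsto_const_nhds (uc φ cφ)
      fun t ht => by simpa using hw t ht
  -- The velocity tends to `0`.
  have lim_of_φ : ∀ f : ℝ × ℝ × ℝ → ℝ, Continuous f → (∀ p, φ p = 0 → f p = 0) →
      Tendsto (fun t => f (X t)) atTop (𝓝 0) := fun f hf h =>
    K_compact.tendsto_zero_of_tendsto_zero hXK' cφ hf (fun p _ => h p) φ_lim
  have v3_lim : Tendsto (fun t => v t ^ 3) atTop (𝓝 0) := by
    refine tendsto_zero_of_tendsto_of_hasDerivAt_add (F := fun t => z t * v t ^ 2)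
      (lim_of_φ (fun p => p.2.1 * p.2.2 ^ 2) (by fun_prop) fun p hp => ?_)
      (lim_of_φ (fun p => φ p * p.2.2 ^ 2 +
        2 * (p.2.1 * p.2.2) * (-h₁ p.1 - h₂ p.2.1 - ψ p)) (by fun_prop) fun p hp => ?_)
      (uc (fun p => p.2.2 ^ 3) (by fun_prop)) fun t ht => ?_
    · rw [pow_two, ← mul_assoc, φ_zero p hp, zero_mul]
    · rw [φ_zero p hp, hp]; ring
    · refine ((hz' t ht).mul ((hv' t ht).pow 2)).congr_deriv ?_
      simp only [hX, Pi.pow_apply]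
      ring
  have v_lim : Tendsto v atTop (𝓝 0) :=
    K_compact.tendsto_zero_of_tendsto_zero hXK' (f := fun p => p.2.2 ^ 3) (g := fun p => p.2.2)
      (by fun_prop) (by fun_prop) (fun p _ hp => pow_eq_zero_iff three_ne_zero |>.1 hp) v3_lim
  -- The elastic force tends to `0`.
  have ψ_lim : Tendsto (fun t => ψ (X t)) atTop (𝓝 0) :=
    K_compact.tendsto_zero_of_tendsto_zero hXK' (f := fun p => p.2.2) (by fun_prop) cψ
      (fun p _ hp => by simp only [hψ, hp, hc0]) v_lim
  have h_lim : Tendsto (fun t => -h₁ (x t) - h₂ (z t)) atTop (𝓝 0) :=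
    tendsto_zero_of_tendsto_of_hasDerivAt_add v_lim (e := fun t => -ψ (X t))
      (by simpa using ψ_lim.neg) (uc (fun p => -h₁ p.1 - h₂ p.2.1) (by fun_prop))
      fun t ht => (hv' t ht).congr_deriv (by ring)
  -- The trajectory has a unique cluster point.
  have cluster : ∀ p, MapClusterPt p atTop X →
      p.2.2 = 0 ∧ -h₁ p.1 - h₂ p.2.1 = 0 ∧ p.2.1 - p.1 = L := fun p hp =>
    ⟨hp.eq_of_tendsto_comp (f := fun p => p.2.2) (by fun_prop) v_lim,
      hp.eq_of_tendsto_comp (f := fun p => -h₁ p.1 - h₂ p.2.1)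
        (Continuous.continuousAt (by fun_prop)) h_lim,
      hp.eq_of_tendsto_comp (f := fun p => p.2.1 - p.1) (by fun_prop) hL⟩
  obtain ⟨p, -, hp⟩ := K_compact.exists_mapClusterPt (le_principal_iff.2 hXK')
  obtain ⟨p3, p1, p2⟩ := cluster p hp
  have X_lim : Tendsto X atTop (𝓝 p) := by
    refine K_compact.tendsto_nhds_of_unique_mapClusterPt hXK' fun q _ hq => ?_
    obtain ⟨q3, q1, q2⟩ := cluster q hq
    have hqp : q.1 = p.1 := by
      rcases lt_trichotomy q.1 p.1 with h | h | h
      · have := hh₁mono h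
        have := hh₂mono (show q.2.1 < p.2.1 by linarith)
        linarith
      · exact h
      · have := hh₁mono h
        have := hh₂mono (show p.2.1 < q.2.1 by linarith)
        linarith
    exact Prod.ext hqp (Prod.ext (by linarith) (by rw [q3, p3]))
  refine ⟨p.1, p.2.1, by linarith, ?_, (continuous_fst.tendsto p).comp X_lim,
    (continuous_snd.fst.tendsto p).comp X_lim, v_lim⟩
  have := le_of_tendsto ((cV.tendsto p).comp X_lim) ((eventually_ge_atTop 0).mono V_le)
  simpa only [hV, hX, p3] using this
end
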